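/- For any μ ∈ M(X_1,T_1): sup_{{U_i}} Σ_{i=1}^k a_i h_μ(T_1, ⋁_{j=i}^k τ_{j−1}^{−1}U_j) = Σ_{i=1}^k a_i h_{τ_{i−1}μ}(T_i), where the supremum is over all tuples of open covers U_i of X_i, i=1,…,k, and h_μ(T_1,·) is the measure-theoretic entropy relative to an open cover. -/

import Mathlib

open MeasureTheory Set Filter Topology
open scoped ENNReal symmDiff

namespace WTP

variable {k : ℕ}

/-- cumulative weight `a 1 + … + a i` (zero-indexed: `a 0 + … + a i`). -/
noncomputable def cw (a : Fin k → ℝ) (i : Fin k) : ℝ := ∑ j ∈ Finset.Iic i, a j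

/-- Birkhoff sum `S_n f = ∑_{l<n} f ∘ T^l`. -/
noncomputable def birk {X : Type*} (T : X → X) (f : X → ℝ) (n : ℕ) (x : X) : ℝ :=
  ∑ l ∈ Finset.range n, f (T^[l] x)

/-- a (finite) open cover of a topological space. -/
def IsOpenCover {X : Type*} [TopologicalSpace X] (𝒰 : Set (Set X)) : Prop :=
  𝒰.Finite ∧ (∀ U ∈ 𝒰, IsOpen U) ∧ ⋃₀ 𝒰 = Set.univ

/-- pullback of a cover along a map. -/
def pullCov {X Y : Type*} (g : X → Y) (𝒰 : Set (Set Y)) : Set (Set X) :=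
  (fun U => g ⁻¹' U) '' 𝒰

/-- the quantity `exp(−s·n + (1/a₁)·sup_{x∈A} S_{⌈a₁ n⌉} f(x))`, as an element of `ℝ≥0∞`. -/
noncomputable def pterm {X : Type*} (T1 : X → X) (f : X → ℝ) (a1 s : ℝ) (n : ℕ)
    (A : Set X) : ℝ≥0∞ :=
  ENNReal.ofReal (Real.exp (-(s * n) + (1 / a1) * sSup (birk T1 f ⌈a1 * (n : ℝ)⌉₊ '' A)))

/-- the weighted Bowen ball `B_n^𝐚(x, ε)`. -/
def wBowen {X : Fin k → Type*} [∀ i, MetricSpace (X i)] {X1 : Type*}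
    (T : ∀ i, X i → X i) (τ : ∀ i, X1 → X i) (a : Fin k → ℝ)
    (n : ℕ) (x : X1) (ε : ℝ) : Set X1 :=
  {y | ∀ i : Fin k, ∀ j < ⌈cw a i * (n : ℝ)⌉₊,
      dist ((T i)^[j] (τ i x)) ((T i)^[j] (τ i y)) < ε}

section Bowen

variable [NeZero k] {X : Fin k → Type*} [∀ i, MetricSpace (X i)] {X1 : Type*}
  [MeasurableSpace X1]

/-- `Λ^{𝐚,s}_{N,ε}(Z,f)`. -/
noncomputable def lamBowenN (T1 : X1 → X1) (T : ∀ i, X i → X i) (τ : ∀ i, X1 → X i)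
    (a : Fin k → ℝ) (f : X1 → ℝ) (s ε : ℝ) (N : ℕ) (Z : Set X1) : ℝ≥0∞ :=
  ⨅ (D : Set (ℕ × Set X1)) (_ : D.Countable)
    (_ : ∀ p ∈ D, N ≤ p.1 ∧ MeasurableSet p.2 ∧ ∃ x : X1, p.2 ⊆ wBowen T τ a p.1 x ε)
    (_ : Z ⊆ ⋃ p ∈ D, p.2),
    ∑' p : D, pterm T1 f (a 0) s p.1.1 p.1.2

/-- `Λ^{𝐚,s}_{ε}(Z,f) = lim_{N→∞} Λ^{𝐚,s}_{N,ε}(Z,f)` (an increasing limit). -/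
noncomputable def lamBowen (T1 : X1 → X1) (T : ∀ i, X i → X i) (τ : ∀ i, X1 → X i)
    (a : Fin k → ℝ) (f : X1 → ℝ) (s ε : ℝ) (Z : Set X1) : ℝ≥0∞ :=
  ⨆ N : ℕ, lamBowenN T1 T τ a f s ε N Z

/-- `P^𝐚(T₁, Z, ε, f) = inf {s : Λ^{𝐚,s}_ε(Z,f) = 0}`. -/
noncomputable def PBowenEps (T1 : X1 → X1) (T : ∀ i, X i → X i) (τ : ∀ i, X1 → X i)
    (a : Fin k → ℝ) (Z : Set X1) (f : X1 → ℝ) (ε : ℝ) : EReal :=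
  sInf (Real.toEReal '' {s : ℝ | lamBowen T1 T τ a f s ε Z = 0})

/-- the 𝐚-weighted topological pressure `P^𝐚(T₁, Z, f) = lim_{ε→0} P^𝐚(T₁, Z, ε, f)`
(an increasing limit as `ε` decreases to `0`). -/
noncomputable def PBowen (T1 : X1 → X1) (T : ∀ i, X i → X i) (τ : ∀ i, X1 → X i)
    (a : Fin k → ℝ) (Z : Set X1) (f : X1 → ℝ) : EReal :=
  ⨆ ε : {e : ℝ // 0 < e}, PBowenEps T1 T τ a Z f ε.1

/-- `W^{𝐚,s}_{N,ε}(Z,f)`. -/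
noncomputable def wBowenWN (T1 : X1 → X1) (T : ∀ i, X i → X i) (τ : ∀ i, X1 → X i)
    (a : Fin k → ℝ) (f : X1 → ℝ) (s ε : ℝ) (N : ℕ) (Z : Set X1) : ℝ≥0∞ :=
  ⨅ (D : Set (ℕ × Set X1 × ℝ≥0∞)) (_ : D.Countable)
    (_ : ∀ p ∈ D, N ≤ p.1 ∧ MeasurableSet p.2.1 ∧ 0 < p.2.2 ∧ p.2.2 ≠ ⊤ ∧
        ∃ x : X1, p.2.1 ⊆ wBowen T τ a p.1 x ε)
    (_ : ∀ z ∈ Z, 1 ≤ ∑' p : D, (p.1.2.1).indicator (fun _ => p.1.2.2) z),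
    ∑' p : D, p.1.2.2 * pterm T1 f (a 0) s p.1.1 p.1.2.1

/-- `W^{𝐚,s}_{ε}(Z,f)`. -/
noncomputable def wBowenW (T1 : X1 → X1) (T : ∀ i, X i → X i) (τ : ∀ i, X1 → X i)
    (a : Fin k → ℝ) (f : X1 → ℝ) (s ε : ℝ) (Z : Set X1) : ℝ≥0∞ :=
  ⨆ N : ℕ, wBowenWN T1 T τ a f s ε N Z

/-- `P_W^𝐚(T₁, Z, ε, f)`. -/
noncomputable def PWBowenEps (T1 : X1 → X1) (T : ∀ i, X i → X i) (τ : ∀ i, X1 → X i)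
    (a : Fin k → ℝ) (Z : Set X1) (f : X1 → ℝ) (ε : ℝ) : EReal :=
  sInf (Real.toEReal '' {s : ℝ | wBowenW T1 T τ a f s ε Z = 0})

/-- the average 𝐚-weighted topological pressure `P_W^𝐚(T₁, Z, f)`. -/
noncomputable def PWBowen (T1 : X1 → X1) (T : ∀ i, X i → X i) (τ : ∀ i, X1 → X i)
    (a : Fin k → ℝ) (Z : Set X1) (f : X1 → ℝ) : EReal :=
  ⨆ ε : {e : ℝ // 0 < e}, PWBowenEps T1 T τ a Z f ε.1

end Bowen

section Local

variable [NeZero k] {X1 : Type*} [MeasurableSpace X1]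

/-- the cover `⋁_{i=1}^k (τ_{i-1}^{-1} 𝒰_i)_0^{⌈(a_1+…+a_i) n⌉ - 1}` on the first space, where
`𝒱 i` is the pulled back cover `τ_{i-1}^{-1} 𝒰_i`. -/
def jointFiber (T1 : X1 → X1) (a : Fin k → ℝ) (𝒱 : Fin k → Set (Set X1)) (n : ℕ) :
    Set (Set X1) :=
  {A | ∃ V : Fin k → ℕ → Set X1,
      (∀ i, ∀ l < ⌈cw a i * (n : ℝ)⌉₊, V i l ∈ 𝒱 i) ∧
      A = ⋂ i : Fin k, ⋂ l ∈ Finset.range ⌈cw a i * (n : ℝ)⌉₊, (T1^[l]) ⁻¹' V i l}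

/-- `Λ^{𝐚,s}_{N,{𝒰_i}}(Z,f)`. -/
noncomputable def lamLocN (T1 : X1 → X1) (a : Fin k → ℝ) (𝒱 : Fin k → Set (Set X1))
    (f : X1 → ℝ) (s : ℝ) (N : ℕ) (Z : Set X1) : ℝ≥0∞ :=
  ⨅ (D : Set (ℕ × Set X1)) (_ : D.Countable)
    (_ : ∀ p ∈ D, N ≤ p.1 ∧ MeasurableSet p.2 ∧ ∃ A ∈ jointFiber T1 a 𝒱 p.1, p.2 ⊆ A)
    (_ : Z ⊆ ⋃ p ∈ D, p.2),
    ∑' p : D, pterm T1 f (a 0) s p.1.1 p.1.2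

/-- `Λ^{𝐚,s}_{{𝒰_i}}(Z,f)`. -/
noncomputable def lamLoc (T1 : X1 → X1) (a : Fin k → ℝ) (𝒱 : Fin k → Set (Set X1))
    (f : X1 → ℝ) (s : ℝ) (Z : Set X1) : ℝ≥0∞ :=
  ⨆ N : ℕ, lamLocN T1 a 𝒱 f s N Z

/-- the local 𝐚-weighted topological pressure `P^𝐚(T₁, Z, {𝒰_i}, f)`, expressed through the
pulled-back covers `𝒱 i = τ_{i-1}^{-1} 𝒰_i`. -/
noncomputable def PLoc (T1 : X1 → X1) (a : Fin k → ℝ) (𝒱 : Fin k → Set (Set X1))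
    (Z : Set X1) (f : X1 → ℝ) : EReal :=
  sInf (Real.toEReal '' {s : ℝ | lamLoc T1 a 𝒱 f s Z = 0})

/-- `W^{𝐚,s}_{N,{𝒰_i}}(Z,f)`. -/
noncomputable def wLocN (T1 : X1 → X1) (a : Fin k → ℝ) (𝒱 : Fin k → Set (Set X1))
    (f : X1 → ℝ) (s : ℝ) (N : ℕ) (Z : Set X1) : ℝ≥0∞ :=
  ⨅ (D : Set (ℕ × Set X1 × ℝ≥0∞)) (_ : D.Countable)
    (_ : ∀ p ∈ D, N ≤ p.1 ∧ MeasurableSet p.2.1 ∧ 0 < p.2.2 ∧ p.2.2 ≠ ⊤ ∧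
        ∃ A ∈ jointFiber T1 a 𝒱 p.1, p.2.1 ⊆ A)
    (_ : ∀ z ∈ Z, 1 ≤ ∑' p : D, (p.1.2.1).indicator (fun _ => p.1.2.2) z),
    ∑' p : D, p.1.2.2 * pterm T1 f (a 0) s p.1.1 p.1.2.1

/-- `W^{𝐚,s}_{{𝒰_i}}(Z,f)`. -/
noncomputable def wLoc (T1 : X1 → X1) (a : Fin k → ℝ) (𝒱 : Fin k → Set (Set X1))
    (f : X1 → ℝ) (s : ℝ) (Z : Set X1) : ℝ≥0∞ :=
  ⨆ N : ℕ, wLocN T1 a 𝒱 f s N Z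

/-- the local average 𝐚-weighted topological pressure `P_W^𝐚(T₁, Z, {𝒰_i}, f)`. -/
noncomputable def PWLoc (T1 : X1 → X1) (a : Fin k → ℝ) (𝒱 : Fin k → Set (Set X1))
    (Z : Set X1) (f : X1 → ℝ) : EReal :=
  sInf (Real.toEReal '' {s : ℝ | wLoc T1 a 𝒱 f s Z = 0})

end Local

/-- iterated join `(𝒰)_0^{n-1} = ⋁_{l=0}^{n-1} T^{-l} 𝒰` of a cover. -/
def covJoinT {X : Type*} (T : X → X) (𝒰 : Set (Set X)) (n : ℕ) : Set (Set X) :=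
  {A | ∃ u : ℕ → Set X, (∀ l < n, u l ∈ 𝒰) ∧
      A = ⋂ l ∈ Finset.range n, (T^[l]) ⁻¹' u l}

/-- the join `⋁_{j=i}^{k} 𝒱 j` of covers of a single space (in applications
`𝒱 j = τ_{j-1}^{-1} 𝒰_j`). -/
def joinFrom {X1 : Type*} (𝒱 : Fin k → Set (Set X1)) (i : Fin k) : Set (Set X1) :=
  {A | ∃ V : Fin k → Set X1, (∀ j, i ≤ j → V j ∈ 𝒱 j) ∧ A = ⋂ j ∈ Finset.Ici i, V j}

/-- a finite measurable partition (indexed). -/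
def IsPart {X : Type*} [MeasurableSpace X] {ι : Type*} (β : ι → Set X) : Prop :=
  (∀ i, MeasurableSet (β i)) ∧ (∀ i j, i ≠ j → Disjoint (β i) (β j)) ∧ ⋃ i, β i = Set.univ

/-- the static entropy `H_μ(β) = -∑ μ(B) log μ(B)` of a finite (indexed) partition. -/
noncomputable def entH {X : Type*} [MeasurableSpace X] {ι : Type*} [Fintype ι]
    (μ : Measure X) (β : ι → Set X) : ℝ :=
  ∑ i, Real.negMulLog (μ (β i)).toReal

/-- the dynamical join `⋁_{l=0}^{n-1} T^{-l} β` of a partition. -/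
def dynJoin {X : Type*} (T : X → X) {ι : Type*} (β : ι → Set X) (n : ℕ) :
    (Fin n → ι) → Set X :=
  fun c => ⋂ l : Fin n, (T^[(l : ℕ)]) ⁻¹' β (c l)

/-- the measure-theoretic entropy `h_μ(T, β) = lim_n (1/n) H_μ(⋁_{l<n} T^{-l}β)` of `T`
relative to a finite partition. -/
noncomputable def hPart {X : Type*} [MeasurableSpace X] {ι : Type*} [Fintype ι]
    (μ : Measure X) (T : X → X) (β : ι → Set X) : EReal :=
  Filter.liminf (fun n : ℕ => ((entH μ (dynJoin T β n) / n : ℝ) : EReal)) Filter.atTop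

/-- the Kolmogorov–Sinai entropy `h_μ(T)`. -/
noncomputable def hKS {X : Type*} [MeasurableSpace X] (μ : Measure X) (T : X → X) : EReal :=
  ⨆ p : (Σ m : ℕ, {β : Fin m → Set X // IsPart β}), hPart μ T p.2.1

/-- `H_μ(𝒰) = inf {H_μ(β) : β a finite measurable partition refining 𝒰}`. -/
noncomputable def covH {X : Type*} [MeasurableSpace X] (μ : Measure X)
    (𝒰 : Set (Set X)) : ℝ :=
  sInf {h : ℝ | ∃ (m : ℕ) (β : Fin m → Set X), IsPart β ∧
      (∀ i, ∃ U ∈ 𝒰, β i ⊆ U) ∧ h = entH μ β}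

/-- the local measure-theoretic entropy `h_μ(T, 𝒰) = lim_n (1/n) H_μ((𝒰)_0^{n-1})` of `T`
relative to an open cover. -/
noncomputable def hCov {X : Type*} [MeasurableSpace X] (μ : Measure X) (T : X → X)
    (𝒰 : Set (Set X)) : EReal :=
  Filter.liminf (fun n : ℕ => ((covH μ (covJoinT T 𝒰 n) / n : ℝ) : EReal)) Filter.atTop

/-- `h⁺_μ(T,𝒰) = inf {h_μ(T,β) : β a finite measurable partition refining 𝒰}`. -/
noncomputable def hCovPlus {X : Type*} [MeasurableSpace X] (μ : Measure X) (T : X → X)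
    (𝒰 : Set (Set X)) : EReal :=
  ⨅ p : (Σ m : ℕ, {β : Fin m → Set X // IsPart β ∧ ∀ i, ∃ U ∈ 𝒰, β i ⊆ U}),
    hPart μ T p.2.1

/-- the join `⋁_{j=i}^{k} γ j` of partitions of a single space (in applications
`γ j = τ_{j-1}^{-1} α_j`). -/
def partJoinFrom {X1 : Type*} {ι : Fin k → Type*} (γ : ∀ j, ι j → Set X1) (i : Fin k) :
    (∀ j : {j : Fin k // i ≤ j}, ι j) → Set X1 :=
  fun c => ⋂ j : {j : Fin k // i ≤ j}, γ j (c j)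

/-- the partition `⋁_{i=1}^k (γ_i)_0^{⌈(a_1+…+a_i)N⌉-1}` on the first space, where
`γ i = τ_{i-1}^{-1} α_i`. -/
def bigPartJoin {X1 : Type*} (T1 : X1 → X1) (a : Fin k → ℝ) {ι : Fin k → Type*}
    (γ : ∀ i, ι i → Set X1) (N : ℕ) :
    (∀ i : Fin k, Fin ⌈cw a i * (N : ℝ)⌉₊ → ι i) → Set X1 :=
  fun c => ⋂ i : Fin k, ⋂ l : Fin ⌈cw a i * (N : ℝ)⌉₊, (T1^[(l : ℕ)]) ⁻¹' γ i (c i l)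

/-- conditional entropy `H_μ(γ|β) = H_μ(γ ∨ β) - H_μ(β)`. -/
noncomputable def condEnt {X : Type*} [MeasurableSpace X] {ι κ : Type*} [Fintype ι] [Fintype κ]
    (μ : Measure X) (γ : ι → Set X) (β : κ → Set X) : ℝ :=
  entH μ (fun p : ι × κ => γ p.1 ∩ β p.2) - entH μ β

/-- the oscillation `w_f(⋁_{i=1}^k τ_{i-1}^{-1} 𝒰_i)` of `f` on the joined cover, where
`𝒱 i = τ_{i-1}^{-1} 𝒰_i`. -/
noncomputable def wfJoin {X1 : Type*} (f : X1 → ℝ) (𝒱 : Fin k → Set (Set X1)) : ℝ :=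
  sSup {d : ℝ | ∃ V : Fin k → Set X1, (∀ i, V i ∈ 𝒱 i) ∧
      ∃ x ∈ ⋂ i, V i, ∃ y ∈ ⋂ i, V i, d = |f x - f y|}

/-- the topological support of a measure. -/
def msupp {X : Type*} [TopologicalSpace X] [MeasurableSpace X] (μ : Measure X) : Set X :=
  {x | ∀ U : Set X, IsOpen U → x ∈ U → 0 < μ U}

section EntropyLemmas

variable {X : Type*} [MeasurableSpace X]

/-- Intersecting one cell from each of finitely many partitions gives a partition. -/
theorem IsPart.iInter {σ : Type*} [Countable σ] {ι : σ → Type*} {β : ∀ s, ι s → Set X}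
    (h : ∀ s, IsPart (β s)) : IsPart (fun c : ∀ s, ι s => ⋂ s, β s (c s)) := by
  refine ⟨fun c => MeasurableSet.iInter fun s => (h s).1 _, fun c d hcd => ?_, ?_⟩
  · obtain ⟨s, hs⟩ := Function.ne_iff.1 hcd
    exact ((h s).2.1 _ _ hs).mono (iInter_subset _ s) (iInter_subset _ s)
  · refine eq_univ_of_forall fun x => ?_
    have hx : ∀ s, ∃ b, x ∈ β s b := fun s => by
      have : x ∈ ⋃ b, β s b := by rw [(h s).2.2]; trivial
      simpa using this
    choose c hc using hx
    exact mem_iUnion.2 ⟨c, mem_iInter.2 hc⟩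

theorem IsPart.preimage {Y : Type*} [MeasurableSpace Y] {g : Y → X} (hg : Measurable g)
    {ι : Type*} {β : ι → Set X} (h : IsPart β) : IsPart (fun b => g ⁻¹' β b) := by
  refine ⟨fun b => hg (h.1 b), fun b c hbc => (h.2.1 b c hbc).preimage g, ?_⟩
  rw [← preimage_iUnion, h.2.2, preimage_univ]

theorem IsPart.comp_equiv {ι κ : Type*} {β : ι → Set X} (h : IsPart β) (e : κ ≃ ι) :
    IsPart (fun b => β (e b)) :=
  ⟨fun b => h.1 _, fun b c hbc => h.2.1 _ _ (e.injective.ne hbc), by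
    rw [e.surjective.iUnion_comp β, h.2.2]⟩

theorem IsPart.dynJoin {T : X → X} (hT : Measurable T) {ι : Type*} {β : ι → Set X}
    (h : IsPart β) (n : ℕ) : IsPart (dynJoin T β n) :=
  IsPart.iInter (β := fun (l : Fin n) b => T^[(l : ℕ)] ⁻¹' β b)
    fun l => h.preimage (hT.iterate l)

theorem IsPart.sum_measureReal_inter {ι : Type*} [Fintype ι] {β : ι → Set X} (h : IsPart β)
    (μ : Measure X) [IsFiniteMeasure μ] (A : Set X) (hA : MeasurableSet A) :
    ∑ b, μ.real (A ∩ β b) = μ.real A := by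
  rw [← measureReal_iUnion_fintype (fun b c hbc => ((h.2.1 b c hbc).mono
    inter_subset_right inter_subset_right)) (fun b => hA.inter (h.1 b)), ← inter_iUnion, h.2.2,
    inter_univ]

theorem IsPart.sum_measureReal {ι : Type*} [Fintype ι] {β : ι → Set X} (h : IsPart β)
    (μ : Measure X) [IsProbabilityMeasure μ] : ∑ b, μ.real (β b) = 1 := by
  simpa using h.sum_measureReal_inter μ univ MeasurableSet.univ

theorem entH_nonneg (μ : Measure X) [IsProbabilityMeasure μ] {ι : Type*} [Fintype ι]
    (β : ι → Set X) : 0 ≤ entH μ β :=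
  Finset.sum_nonneg fun _ _ => Real.negMulLog_nonneg ENNReal.toReal_nonneg measureReal_le_one

/-- Gibbs' inequality, one term at a time. -/
theorem mul_neg_log_le {p P Q : ℝ} (hp : 0 ≤ p) (hP : p ≤ P) (hQ0 : 0 ≤ Q)
    (hQ : 0 < p → 0 < Q) : p * -Real.log P ≤ p * -Real.log Q + (Q - p) := by
  rcases hp.eq_or_lt with rfl | hp
  · simpa using hQ0
  · have hQ := hQ hp
    have h1 := Real.log_le_log hp hP
    have h2 := Real.log_le_sub_one_of_pos (div_pos hQ hp)
    rw [Real.log_div hQ.ne' hp.ne'] at h2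
    have h3 : p * (Q / p - 1) = Q - p := by field_simp
    nlinarith

/-- A Fano-type inequality: if the `l`-th coordinate of the cell of `γ` can be guessed from
the cell of `β` outside a set `E l` of small measure, then the entropy of `γ` exceeds that of
`β` by little. -/
theorem entH_le_of_guess (μ : Measure X) [IsProbabilityMeasure μ] {ι κ : Type*} [Fintype ι]
    [Fintype κ] {n : ℕ} {γ : (Fin n → ι) → Set X} {β : κ → Set X}
    (hγ : IsPart γ) (hβ : IsPart β) {q : ι → ι → ℝ} (hq : ∀ i j, 0 < q i j)
    (hq1 : ∀ j, ∑ i, q i j ≤ 1) {C D η : ℝ} (hD : 0 ≤ D) (hC : ∀ i, -Real.log (q i i) ≤ C)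
    (hCD : ∀ i j, -Real.log (q i j) ≤ C + D) (J : Fin n → κ → ι) {E : Fin n → Set X}
    (hE : ∀ l, MeasurableSet (E l)) (hη : ∀ l, μ.real (E l) ≤ η)
    (hJ : ∀ l c b, c l ≠ J l b → γ c ∩ β b ⊆ E l) :
    entH μ γ ≤ entH μ β + n * (C + D * η) := by
  have hterm : ∀ c b, μ.real (γ c ∩ β b) * -Real.log (μ.real (γ c)) ≤
      μ.real (γ c ∩ β b) * -Real.log (μ.real (β b)) +
        ∑ l, (μ.real (γ c ∩ β b) * C + D * μ.real (E l ∩ γ c ∩ β b)) +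
        (μ.real (β b) * ∏ l, q (c l) (J l b) - μ.real (γ c ∩ β b)) := by
    intro c b
    have hprod : 0 < ∏ l, q (c l) (J l b) := Finset.prod_pos fun l _ => hq _ _
    have hR : 0 < μ.real (γ c ∩ β b) → 0 < μ.real (β b) := fun h =>
      h.trans_le (measureReal_mono inter_subset_right)
    refine (mul_neg_log_le measureReal_nonneg (measureReal_mono inter_subset_left)
      (mul_nonneg measureReal_nonneg hprod.le) fun h => mul_pos (hR h) hprod).trans ?_
    gcongr
    rcases (measureReal_nonneg (μ := μ) (s := γ c ∩ β b)).eq_or_lt with h0 | h0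
    · rw [← h0]
      simp only [zero_mul, zero_add]
      exact Finset.sum_nonneg fun l _ => mul_nonneg hD measureReal_nonneg
    · rw [Real.log_mul (hR h0).ne' hprod.ne', Real.log_prod (fun l _ => (hq _ _).ne'), neg_add,
        mul_add, ← Finset.sum_neg_distrib, Finset.mul_sum]
      gcongr with l
      by_cases hl : c l = J l b
      · rw [hl]
        have := mul_le_mul_of_nonneg_left (hC (J l b)) h0.le
        have := mul_nonneg hD (measureReal_nonneg (μ := μ) (s := E l ∩ γ c ∩ β b))
        linarith
      · rw [inter_assoc, inter_eq_right.2 (hJ l c b hl)]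
        have := mul_le_mul_of_nonneg_left (hCD (c l) (J l b)) h0.le
        linarith
  have hsum := Finset.sum_le_sum fun c (_ : c ∈ Finset.univ) =>
    Finset.sum_le_sum fun b (_ : b ∈ Finset.univ) => hterm c b
  have hγsum : ∑ c, ∑ b, μ.real (γ c ∩ β b) = 1 := by
    simp_rw [hβ.sum_measureReal_inter μ _ (hγ.1 _), hγ.sum_measureReal]
  have h1 : ∑ c, ∑ b, μ.real (γ c ∩ β b) * -Real.log (μ.real (γ c)) = entH μ γ := by
    simp_rw [← Finset.sum_mul, hβ.sum_measureReal_inter μ _ (hγ.1 _)]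
    simp [entH, Real.negMulLog, Measure.real]
  have h2 : ∑ c, ∑ b, μ.real (γ c ∩ β b) * -Real.log (μ.real (β b)) = entH μ β := by
    rw [Finset.sum_comm]
    simp_rw [← Finset.sum_mul, inter_comm (γ _), hγ.sum_measureReal_inter μ _ (hβ.1 _)]
    simp [entH, Real.negMulLog, Measure.real]
  have h3 : ∑ c, ∑ b, ∑ l, (μ.real (γ c ∩ β b) * C + D * μ.real (E l ∩ γ c ∩ β b)) ≤
      n * (C + D * η) := by
    have : ∀ l, ∑ c, ∑ b, (μ.real (γ c ∩ β b) * C + D * μ.real (E l ∩ γ c ∩ β b)) ≤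
        C + D * η := fun l => by
      simp_rw [Finset.sum_add_distrib, ← Finset.mul_sum, ← Finset.sum_mul, hγsum,
        hβ.sum_measureReal_inter μ _ ((hE l).inter (hγ.1 _)),
        hγ.sum_measureReal_inter μ _ (hE l)]
      have := mul_le_mul_of_nonneg_left (hη l) hD
      linarith
    calc _ = ∑ l, ∑ c, ∑ b, (μ.real (γ c ∩ β b) * C + D * μ.real (E l ∩ γ c ∩ β b)) := by
          rw [Finset.sum_comm (s := (Finset.univ : Finset (Fin n)))]
          exact Finset.sum_congr rfl fun c _ => Finset.sum_comm
      _ ≤ ∑ l : Fin n, (C + D * η) := Finset.sum_le_sum fun l _ => this l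
      _ = _ := by rw [Finset.sum_const, Finset.card_univ, Fintype.card_fin, nsmul_eq_mul]
  have h4 : ∑ c : Fin n → ι, ∑ b, μ.real (β b) * ∏ l, q (c l) (J l b) ≤ 1 := by
    rw [Finset.sum_comm, ← hβ.sum_measureReal μ]
    refine Finset.sum_le_sum fun b _ => ?_
    rw [← Finset.mul_sum]
    refine mul_le_of_le_one_right measureReal_nonneg ?_
    have := Finset.prod_univ_sum (fun _ : Fin n => (Finset.univ : Finset ι))
      (fun l i => q i (J l b))
    rw [Fintype.piFinset_univ] at this
    rw [← this]
    exact Finset.prod_le_one (fun l _ => Finset.sum_nonneg fun i _ => (hq _ _).le)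
      fun l _ => hq1 _
  simp only [Finset.sum_add_distrib, Finset.sum_sub_distrib] at hsum h3
  linarith

end EntropyLemmas

section CoverLemmas

variable {X : Type*}

theorem covH_nonneg [MeasurableSpace X] (μ : Measure X) [IsProbabilityMeasure μ] (𝒰 : Set (Set X)) :
    0 ≤ covH μ 𝒰 := by
  refine Real.sInf_nonneg ?_
  rintro _ ⟨m, β, -, -, rfl⟩
  exact entH_nonneg μ β

theorem hCov_nonneg [MeasurableSpace X] (μ : Measure X) [IsProbabilityMeasure μ] (T : X → X) (𝒰 : Set (Set X)) :
    0 ≤ hCov μ T 𝒰 :=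
  le_liminf_of_le (h := Eventually.of_forall fun n =>
    EReal.coe_nonneg.2 (div_nonneg (covH_nonneg μ _) n.cast_nonneg))

theorem covH_le_entH [MeasurableSpace X] (μ : Measure X) [IsProbabilityMeasure μ] {𝒰 : Set (Set X)} {ι : Type*}
    [Fintype ι] {β : ι → Set X} (hβ : IsPart β) (h : ∀ b, ∃ U ∈ 𝒰, β b ⊆ U) :
    covH μ 𝒰 ≤ entH μ β := by
  refine csInf_le ⟨0, ?_⟩ ⟨Fintype.card ι, _, hβ.comp_equiv (Fintype.equivFin ι).symm,
    fun b => h _, ?_⟩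
  · rintro _ ⟨m, β, -, -, rfl⟩
    exact entH_nonneg μ β
  · exact ((Fintype.equivFin ι).symm.sum_comp fun b => Real.negMulLog (μ (β b)).toReal).symm

theorem le_covH [MeasurableSpace X] (μ : Measure X) {𝒰 : Set (Set X)} {ι : Type*} [Fintype ι] {β : ι → Set X}
    (hβ : IsPart β) (h : ∀ b, ∃ U ∈ 𝒰, β b ⊆ U) {r : ℝ}
    (hr : ∀ (m : ℕ) (α : Fin m → Set X), IsPart α → (∀ b, ∃ U ∈ 𝒰, α b ⊆ U) → r ≤ entH μ α) :
    r ≤ covH μ 𝒰 := by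
  refine le_csInf ⟨_, Fintype.card ι, _, hβ.comp_equiv (Fintype.equivFin ι).symm,
    fun b => h _, rfl⟩ ?_
  rintro _ ⟨m, α, hα, h, rfl⟩
  exact hr m α hα h

theorem dynJoin_refines (T : X → X) {𝒰 : Set (Set X)} {ι : Type*} {β : ι → Set X}
    (h : ∀ b, ∃ U ∈ 𝒰, β b ⊆ U) (n : ℕ) (c : Fin n → ι) :
    ∃ U ∈ covJoinT T 𝒰 n, dynJoin T β n c ⊆ U := by
  choose U hU hβU using h
  refine ⟨_, ⟨fun l => if hl : l < n then U (c ⟨l, hl⟩) else univ, fun l hl => ?_, rfl⟩, ?_⟩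
  · simpa [hl] using hU _
  · refine subset_iInter₂ fun l hl => ?_
    have hl := Finset.mem_range.1 hl
    simp only [hl, dite_true]
    exact (iInter_subset _ (⟨l, hl⟩ : Fin n)).trans (preimage_mono (hβU _))

/-- `hCov` is monotone under refinement, as soon as the finer cover is refined by some finite
measurable partition. -/
theorem hCov_mono [MeasurableSpace X] (μ : Measure X) [IsProbabilityMeasure μ] {T : X → X} (hT : Measurable T)
    {𝒰 𝒱 : Set (Set X)} (h : ∀ V ∈ 𝒱, ∃ U ∈ 𝒰, V ⊆ U) {ι : Type*} [Fintype ι]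
    {β : ι → Set X} (hβ : IsPart β) (hβV : ∀ b, ∃ V ∈ 𝒱, β b ⊆ V) :
    hCov μ T 𝒰 ≤ hCov μ T 𝒱 := by
  refine liminf_le_liminf (Eventually.of_forall fun n => EReal.coe_le_coe_iff.2 ?_)
  refine div_le_div_of_nonneg_right ?_ n.cast_nonneg
  refine le_covH μ (hβ.dynJoin hT n) (dynJoin_refines T hβV n) fun m α hα hαV => ?_
  refine covH_le_entH μ hα fun b => ?_
  obtain ⟨_, ⟨u, hu, rfl⟩, hb⟩ := hαV b
  choose! w hw huw using h
  exact ⟨_, ⟨fun l => w (u l), fun l hl => hw _ (hu l hl), rfl⟩, hb.trans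
    (iInter₂_mono fun l hl => preimage_mono (huw _ (hu l (Finset.mem_range.1 hl))))⟩

theorem dynJoin_preimage {Y : Type*} {T : X → X} {S : Y → Y} {τ : X → Y}
    (hτ : τ ∘ T = S ∘ τ) {ι : Type*} (β : ι → Set Y) (n : ℕ) (c : Fin n → ι) :
    dynJoin T (fun b => τ ⁻¹' β b) n c = τ ⁻¹' dynJoin S β n c := by
  have hs : Function.Semiconj τ T S := fun x => congrFun hτ x
  ext x
  simp [dynJoin, (hs.iterate_right _).eq]

theorem entH_preimage [MeasurableSpace X] {Y : Type*} [MeasurableSpace Y] (μ : Measure X) {τ : X → Y}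
    (hτ : Measurable τ) {ι : Type*} [Fintype ι] {β : ι → Set Y} (hβ : IsPart β) :
    entH μ (fun b => τ ⁻¹' β b) = entH (μ.map τ) β := by
  simp only [entH, Measure.map_apply hτ (hβ.1 _)]

/-- The local entropy of a cover is at most the Kolmogorov–Sinai entropy of a factor carrying a
partition whose pullback refines the cover. -/
theorem hCov_le_hKS [MeasurableSpace X] {Y : Type*} [MeasurableSpace Y] (μ : Measure X) [IsProbabilityMeasure μ]
    {T : X → X} (hT : Measurable T) {S : Y → Y} (hS : Measurable S) {τ : X → Y}
    (hτ : Measurable τ) (hτe : τ ∘ T = S ∘ τ) {𝒰 : Set (Set X)} {m : ℕ} {β : Fin m → Set Y}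
    (hβ : IsPart β) (h : ∀ b, ∃ U ∈ 𝒰, τ ⁻¹' β b ⊆ U) :
    hCov μ T 𝒰 ≤ hKS (μ.map τ) S := by
  refine le_trans ?_ (le_iSup (fun p : (Σ m : ℕ, {β : Fin m → Set Y // IsPart β}) =>
    hPart (μ.map τ) S p.2.1) ⟨m, β, hβ⟩)
  refine liminf_le_liminf (Eventually.of_forall fun n => EReal.coe_le_coe_iff.2 ?_)
  refine div_le_div_of_nonneg_right ?_ n.cast_nonneg
  rw [← entH_preimage μ hτ (hβ.dynJoin hS n)]
  simp_rw [← dynJoin_preimage hτe]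
  exact covH_le_entH μ ((hβ.preimage hτ).dynJoin hT n) (dynJoin_refines T h n)

/-- A finite open cover is refined by a finite measurable partition. -/
theorem IsOpenCover.exists_isPart {Y : Type*} [TopologicalSpace Y] [MeasurableSpace Y]
    [OpensMeasurableSpace Y] {𝒰 : Set (Set Y)} (h : IsOpenCover 𝒰) :
    ∃ (m : ℕ) (β : Fin m → Set Y), IsPart β ∧ ∀ b, ∃ U ∈ 𝒰, β b ⊆ U := by
  obtain ⟨m, f, -, rfl⟩ := h.1.fin_param
  refine ⟨m, disjointed f, ⟨fun b => ?_, fun b c hbc => disjoint_disjointed f hbc, ?_⟩,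
    fun b => ⟨f b, mem_range_self b, disjointed_subset f b⟩⟩
  · exact disjointedRec (fun t c ht => ht.diff (h.2.1 _ (mem_range_self c)).measurableSet)
      (h.2.1 _ (mem_range_self b)).measurableSet
  · rw [iUnion_disjointed, ← sUnion_range, h.2.2]

/-- The entropy of a factor relative to a partition is approximated from below by the entropies
relative to pullbacks of open covers. -/
theorem hPart_le_iSup_hCov {X Y : Type*} [MeasurableSpace X] [TopologicalSpace Y]
    [TopologicalSpace.PseudoMetrizableSpace Y] [MeasurableSpace Y] [BorelSpace Y] (μ : Measure X)
    [IsProbabilityMeasure μ] {T : X → X} (hT : MeasurePreserving T μ μ) {S : Y → Y}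
    (hS : Measurable S) {τ : X → Y} (hτ : Measurable τ) (hτe : τ ∘ T = S ∘ τ) {m : ℕ}
    {α : Fin m → Set Y} (hα : IsPart α) :
    hPart (μ.map τ) S α ≤
      ⨆ 𝒰 : {𝒰 : Set (Set Y) // IsOpenCover 𝒰}, hCov μ T (pullCov τ 𝒰.1) := by
  classical
  refine EReal.ge_of_forall_gt_iff_ge.1 fun r hr => ?_
  obtain ⟨s, hrs, hs⟩ := EReal.lt_iff_exists_real_btwn.1 hr
  obtain ⟨ε, hε, rfl⟩ : ∃ ε > 0, s = r + ε :=
    ⟨s - r, sub_pos.2 (EReal.coe_lt_coe_iff.1 hrs), by ring⟩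
  have : IsProbabilityMeasure (μ.map τ) := Measure.isProbabilityMeasure_map hτ.aemeasurable
  have hm : 0 < m := by
    rcases Nat.eq_zero_or_pos m with rfl | h
    · simpa using hα.sum_measureReal (μ.map τ)
    · exact h
  have hm1 : (1 : ℝ) ≤ m := by exact_mod_cast hm
  set e := Real.exp (-(ε / 2)) with he
  have he0 : 0 < e := Real.exp_pos _
  have he1 : e < 1 := Real.exp_lt_one_iff.2 (by linarith)
  have hq0 : 0 < (1 - e) / m := div_pos (by linarith) (by linarith)
  have hq1 : (1 - e) / m ≤ 1 := (div_le_one (by linarith)).2 (by linarith)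
  set q : Fin m → Fin m → ℝ := fun i j => if i = j then e else (1 - e) / m with hq
  set D := -Real.log ((1 - e) / m) with hDdef
  have hD : 0 ≤ D := neg_nonneg.2 (Real.log_nonpos hq0.le hq1)
  have hC : -Real.log e = ε / 2 := by rw [he, Real.log_exp, neg_neg]
  set η := ε / 2 / (D + 1) with hη
  have hη0 : 0 < η := by positivity
  have hDη : D * η ≤ ε / 2 := by
    rw [hη, mul_div_assoc', div_le_iff₀ (by linarith)]
    nlinarith
  have hK : ∀ j, ∃ K ⊆ α j, IsClosed K ∧ (μ.map τ) (α j \ K) < ENNReal.ofReal (η / m) :=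
    fun j => (hα.1 j).exists_isClosed_sdiff_lt (measure_ne_top _ _)
      (ENNReal.ofReal_pos.2 (by positivity)).ne'
  choose K hKα hKc hKη using hK
  set U : Fin m → Set Y := fun j => ⋂ l ∈ {l | l ≠ j}, (K l)ᶜ with hU
  have hUcov : IsOpenCover (range U) := by
    refine ⟨finite_range U, ?_, eq_univ_of_forall fun y => ?_⟩
    · rintro _ ⟨j, rfl⟩
      exact (toFinite _).isOpen_biInter fun l _ => (hKc l).isOpen_compl
    · obtain ⟨j, hj⟩ := mem_iUnion.1 (hα.2.2 ▸ mem_univ y)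
      exact ⟨U j, mem_range_self j, mem_iInter₂.2 fun l hl hy =>
        disjoint_left.1 (hα.2.1 l j hl) (hKα l hy) hj⟩
  set E : Set Y := ⋃ j, α j \ K j with hE
  have hEm : MeasurableSet E :=
    MeasurableSet.iUnion fun j => (hα.1 j).diff (hKc j).measurableSet
  have hEη : (μ.map τ).real E ≤ η := by
    refine (measureReal_iUnion_fintype_le _).trans ?_
    refine (Finset.sum_le_sum (g := fun _ => η / m) fun j _ => ?_).trans ?_
    · exact ENNReal.toReal_le_of_le_ofReal (by positivity) (hKη j).le
    · simp
      field_simp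
      exact le_rfl
  have key : ∀ n : ℕ, entH (μ.map τ) (dynJoin S α n) ≤
      covH μ (covJoinT T (pullCov τ (range U)) n) + n * ε := fun n => by
    obtain ⟨M, δ, hδ, hδU⟩ := hUcov.exists_isPart
    have hδU' : ∀ b, ∃ V ∈ pullCov τ (range U), τ ⁻¹' δ b ⊆ V := fun b => by
      obtain ⟨V, hV, h⟩ := hδU b
      exact ⟨_, ⟨V, hV, rfl⟩, preimage_mono h⟩
    rw [← sub_le_iff_le_add]
    refine le_covH μ ((hδ.preimage hτ).dynJoin hT.measurable n) (dynJoin_refines T hδU' n)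
      fun N β hβ hβV => ?_
    rw [sub_le_iff_le_add]
    have hJ : ∀ b, ∃ J : Fin n → Fin m, ∀ l : Fin n, β b ⊆ T^[l] ⁻¹' (τ ⁻¹' U (J l)) := fun b => by
      obtain ⟨_, ⟨u, hu, rfl⟩, hb⟩ := hβV b
      have : ∀ l : Fin n, ∃ j, τ ⁻¹' U j = u l := fun l => by
        obtain ⟨_, ⟨j, rfl⟩, h⟩ := hu l l.2
        exact ⟨j, h⟩
      choose J hJ using this
      refine ⟨J, fun l => ?_⟩
      rw [hJ]
      exact hb.trans (iInter₂_subset (l : ℕ) (Finset.mem_range.2 l.2))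
    choose J hJ using hJ
    have hmain := entH_le_of_guess μ (n := n) (q := q) (C := ε / 2) (D := D) (η := η)
      ((hα.preimage hτ).dynJoin hT.measurable n) hβ
      (fun i j => by simp only [hq]; split_ifs <;> assumption)
      (fun j => by
        have : ∀ i, q i j ≤ (1 - e) / m + if i = j then e else 0 := fun i => by
          simp only [hq]; split_ifs <;> linarith
        refine (Finset.sum_le_sum fun i _ => this i).trans ?_
        rw [Finset.sum_add_distrib]
        simp
        field_simp
        simp)
      hD (fun i => by simp [hq, hC])
      (fun i j => by
        simp only [hq]
        split_ifs
        · linarith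
        · linarith)
      (fun l b => J b l) (E := fun l => T^[(l : ℕ)] ⁻¹' (τ ⁻¹' E))
      (fun l => hT.measurable.iterate l (hτ hEm))
      (fun l => by
        rw [(hT.iterate l).measureReal_preimage (hτ hEm).nullMeasurableSet,
          ← map_measureReal_apply hτ hEm]
        exact hEη)
      (fun l c b hl x hx => by
        have h1 : τ (T^[l] x) ∈ α (c l) := mem_iInter.1 hx.1 l
        have h2 : τ (T^[l] x) ∈ U (J b l) := hJ b l hx.2
        exact mem_iUnion.2 ⟨c l, h1, mem_iInter₂.1 h2 (c l) hl⟩)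
    rw [← entH_preimage μ hτ (hα.dynJoin hS n)]
    simp_rw [← dynJoin_preimage hτe]
    refine hmain.trans ?_
    gcongr
    linarith
  refine le_trans ?_ (le_iSup _ (⟨range U, hUcov⟩ : {𝒰 : Set (Set Y) // IsOpenCover 𝒰}))
  refine le_liminf_of_le (h := ?_)
  filter_upwards [eventually_lt_of_lt_liminf hs, eventually_gt_atTop 0] with n hn hn0
  have hn0 : (0 : ℝ) < n := by exact_mod_cast hn0
  rw [EReal.coe_lt_coe_iff, lt_div_iff₀ hn0] at hn
  rw [EReal.coe_le_coe_iff, le_div_iff₀ hn0]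
  linarith [key n]

/-- Suprema of independent nonnegative families distribute over weighted sums. -/
theorem sum_mul_iSup_le {ι : Type*} [Fintype ι] {κ : ι → Type*} [∀ i, Nonempty (κ i)]
    {a : ι → ℝ} (ha : ∀ i, 0 ≤ a i) {f : ∀ i, κ i → EReal} (hf : ∀ i u, 0 ≤ f i u) {s : EReal}
    (hs : ∀ u : ∀ i, κ i, ∑ i, (a i : EReal) * f i (u i) ≤ s) :
    ∑ i, (a i : EReal) * ⨆ u, f i u ≤ s := by
  have hseq : ∀ i, ∃ u : ℕ → κ i, Tendsto (fun n => f i (u n)) atTop (𝓝 (⨆ u, f i u)) :=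
    fun i => by
      obtain ⟨v, -, hv, hmem⟩ :=
        exists_seq_tendsto_sSup (range_nonempty (f i)) (OrderTop.bddAbove _)
      choose u hu using hmem
      exact ⟨u, by simpa only [hu, sSup_range] using hv⟩
  choose u hu using hseq
  have hlim : ∀ t : Finset ι, Tendsto (fun n => ∑ i ∈ t, (a i : EReal) * f i (u i n)) atTop
      (𝓝 (∑ i ∈ t, (a i : EReal) * ⨆ u, f i u)) := fun t => by
    classical
    have hnn : ∀ i, 0 ≤ (a i : EReal) * ⨆ u, f i u := fun i =>
      mul_nonneg (EReal.coe_nonneg.2 (ha i)) ((hf i (u i 0)).trans (le_iSup _ _))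
    have hbot : ∀ {x : EReal}, 0 ≤ x → x ≠ ⊥ := fun h => (EReal.bot_lt_zero.trans_le h).ne'
    induction t using Finset.induction_on with
    | empty => simp
    | insert i t hi ih =>
      simp only [Finset.sum_insert hi]
      refine (EReal.continuousAt_add (.inr (hbot (Finset.sum_nonneg fun j _ => hnn j)))
        (.inl (hbot (hnn i)))).tendsto.comp (Tendsto.prodMk_nhds ?_ ih)
      exact EReal.Tendsto.const_mul (hu i) (by simp) (by simp)
  exact le_of_tendsto' (hlim Finset.univ) fun n => hs fun i => u i n

/-- The join of pullbacks of open covers along a tower of factor maps is refined by the pullback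
of a partition of the first factor involved. -/
theorem exists_isPart_preimage_refines_joinFrom {X1 : Type*} {X : Fin k → Type*}
    [∀ i, TopologicalSpace (X i)] [∀ i, MeasurableSpace (X i)] [∀ i, BorelSpace (X i)]
    {τ : ∀ i, X1 → X i} {i : Fin k}
    (hp : ∀ j, i ≤ j → ∃ p : X i → X j, Continuous p ∧ p ∘ τ i = τ j)
    {𝒰 : ∀ j, Set (Set (X j))} (h𝒰 : ∀ j, IsOpenCover (𝒰 j)) :
    ∃ (m : ℕ) (β : Fin m → Set (X i)), IsPart β ∧
      ∀ b, ∃ A ∈ joinFrom (fun j => pullCov (τ j) (𝒰 j)) i, τ i ⁻¹' β b ⊆ A := by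
  classical
  choose p hpc hpτ using hp
  choose m α hα hαU using fun j => (h𝒰 j).exists_isPart
  choose U hU hαU using hαU
  have hpart := IsPart.iInter (β := fun (j : {j // i ≤ j}) b => p j.1 j.2 ⁻¹' α j.1 b)
    fun j => (hα j.1).preimage (hpc j.1 j.2).measurable
  refine ⟨_, _, hpart.comp_equiv (Fintype.equivFin _).symm, fun b => ?_⟩
  set c := (Fintype.equivFin (∀ j : {j // i ≤ j}, Fin (m j.1))).symm b
  refine ⟨_, ⟨fun j => if hj : i ≤ j then τ j ⁻¹' U j (c ⟨j, hj⟩) else univ, fun j hj => ?_, rfl⟩,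
    subset_iInter₂ fun j hj => ?_⟩
  · simp only [hj, dite_true]
    exact ⟨_, hU _ _, rfl⟩
  · have hj := Finset.mem_Ici.1 hj
    simp only [hj, dite_true]
    rw [← hpτ j hj, preimage_comp]
    exact preimage_mono ((iInter_subset _ (⟨j, hj⟩ : {j // i ≤ j})).trans
      (preimage_mono (hαU _ _)))

end CoverLemmas

/-- For any `μ ∈ M(X₁,T₁)`,
`sup_{{𝒰_i}} ∑_i a_i h_μ(T₁, ⋁_{j=i}^k τ_{j-1}^{-1}𝒰_j) = ∑_i a_i h_{τ_{i-1}μ}(T_i)`. -/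
theorem sup_local_weighted_entropy_eq
    {k : ℕ} [NeZero k]
    (X : Fin k → Type) [∀ i, MetricSpace (X i)] [∀ i, CompactSpace (X i)]
    [∀ i, MeasurableSpace (X i)] [∀ i, BorelSpace (X i)]
    (T : ∀ i, X i → X i) (hT : ∀ i, Continuous (T i))
    (τ : ∀ i, X 0 → X i) (hτ0 : τ 0 = id)
    (hτc : ∀ i, Continuous (τ i)) (hτs : ∀ i, Function.Surjective (τ i))
    (hτe : ∀ i, τ i ∘ T 0 = T i ∘ τ i)
    (hchain : ∀ i j : Fin k, i ≤ j → ∃ p : X i → X j,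
        Continuous p ∧ p ∘ T i = T j ∘ p ∧ p ∘ τ i = τ j)
    (a : Fin k → ℝ) (ha1 : 0 < a 0) (ha : ∀ i, 0 ≤ a i)
    (μ : Measure (X 0)) [IsProbabilityMeasure μ] (hμ : μ.map (T 0) = μ) :
    (⨆ 𝒰 : {𝒰 : ∀ i, Set (Set (X i)) // ∀ i, IsOpenCover (𝒰 i)},
        ∑ i : Fin k, ((a i : ℝ) : EReal) *
          hCov μ (T 0) (joinFrom (fun j => pullCov (τ j) (𝒰.1 j)) i))
      = ∑ i : Fin k, ((a i : ℝ) : EReal) * hKS (μ.map (τ i)) (T i) := by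
  have hTm : ∀ i, Measurable (T i) := fun i => (hT i).measurable
  have hτm : ∀ i, Measurable (τ i) := fun i => (hτc i).measurable
  have hpart := fun (𝒰 : ∀ i, Set (Set (X i))) (h𝒰 : ∀ i, IsOpenCover (𝒰 i)) i =>
    exists_isPart_preimage_refines_joinFrom (τ := τ) (i := i)
      (fun j hj => (hchain i j hj).imp fun _ hp => ⟨hp.1, hp.2.2⟩) h𝒰
  refine le_antisymm (iSup_le fun 𝒰 => Finset.sum_le_sum fun i _ => ?_) ?_
  · obtain ⟨m, β, hβ, hβU⟩ := hpart 𝒰.1 𝒰.2 i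
    exact mul_le_mul_of_nonneg_left (hCov_le_hKS μ (hTm 0) (hTm i) (hτm i) (hτe i) hβ hβU)
      (EReal.coe_nonneg.2 (ha i))
  · have hne : ∀ i, Nonempty {𝒰 : Set (Set (X i)) // IsOpenCover 𝒰} := fun i =>
      ⟨{univ}, finite_singleton _, by simp, by simp⟩
    calc ∑ i, (a i : EReal) * hKS (μ.map (τ i)) (T i)
        ≤ ∑ i, (a i : EReal) * ⨆ 𝒰 : {𝒰 : Set (Set (X i)) // IsOpenCover 𝒰},
            hCov μ (T 0) (pullCov (τ i) 𝒰.1) := by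
          refine Finset.sum_le_sum fun i _ =>
            mul_le_mul_of_nonneg_left (iSup_le fun p => ?_) (EReal.coe_nonneg.2 (ha i))
          exact hPart_le_iSup_hCov μ ⟨hTm 0, hμ⟩ (hTm i) (hτm i) (hτe i) p.2.2
      _ ≤ _ := by
          refine sum_mul_iSup_le ha (fun i 𝒰 => hCov_nonneg μ _ _) fun 𝒰 => ?_
          refine le_trans (Finset.sum_le_sum fun i _ => mul_le_mul_of_nonneg_left ?_
            (EReal.coe_nonneg.2 (ha i))) (le_iSup (fun 𝒰 : {𝒰 : ∀ i, Set (Set (X i)) //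
            ∀ i, IsOpenCover (𝒰 i)} => ∑ i : Fin k, (a i : EReal) *
              hCov μ (T 0) (joinFrom (fun j => pullCov (τ j) (𝒰.1 j)) i))
            ⟨fun i => (𝒰 i).1, fun i => (𝒰 i).2⟩)
          obtain ⟨m, β, hβ, hβU⟩ := hpart (fun i => (𝒰 i).1) (fun i => (𝒰 i).2) i
          refine hCov_mono μ (hTm 0) ?_ (hβ.preimage (hτm i)) hβU
          rintro _ ⟨V, hV, rfl⟩
          exact ⟨V i, hV i le_rfl, biInter_subset_of_mem (Finset.mem_Ici.2 le_rfl)⟩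

end WTP
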